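/- arXiv:2107.08740 — 6 statements merged into one kernel-verified Lean document; each statement's English description precedes it below -/
import Mathlib

section
/- Let M be a simple-𝔊-torsion-free R-module. Then the annihilator Ann_R(M) belongs to 𝔊*. -/
section Defs

variable (R : Type*) [CommRing R]

/-- A Gabriel topology on the commutative ring `R`: contains `R`, is upward closed,
is closed under colon by elements, and satisfies the Gabriel axiom. -/
def IsGabrielTopology (G : Set (Ideal R)) : Prop :=
  ⊤ ∈ G ∧
  (∀ a b : Ideal R, a ∈ G → a ≤ b → b ∈ G) ∧
  (∀ a ∈ G, ∀ r : R, Submodule.colon a (Ideal.span {r}) ∈ G) ∧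
  (∀ b : Ideal R, (∃ a ∈ G, ∀ x ∈ a, Submodule.colon b (Ideal.span {x}) ∈ G) → b ∈ G)

/-- `𝔊*`: the maximal elements of `Spec R \ 𝔊`. -/
def GStar (G : Set (Ideal R)) : Set (Ideal R) :=
  {p | p.IsPrime ∧ p ∉ G ∧ ∀ q : Ideal R, q.IsPrime → p < q → q ∈ G}

variable (M : Type*) [AddCommGroup M] [Module R M]

/-- `M` is `𝔊`-torsion-free: no nonzero element is annihilated by an ideal of `𝔊`. -/
def IsGTorsionFree (G : Set (Ideal R)) : Prop :=
  ∀ a ∈ G, ∀ x : M, (∀ r ∈ a, r • x = 0) → x = 0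

/-- `M` is `𝔊`-torsion: every element is annihilated by some ideal of `𝔊`. -/
def IsGTorsion (G : Set (Ideal R)) : Prop :=
  ∀ x : M, ∃ a ∈ G, ∀ r ∈ a, r • x = 0

/-- `M` is simple-`𝔊`-torsion-free. -/
def IsSimpleGTorsionFree (G : Set (Ideal R)) : Prop :=
  IsGTorsionFree R M G ∧ (∃ x : M, x ≠ 0) ∧
    ∀ U : Submodule R M, U ≠ ⊥ → U ≠ ⊤ → ¬ IsGTorsionFree R (M ⧸ U) G

/-- `M` is `𝔊`-divisible: `𝔞M = M` for all `𝔞 ∈ 𝔊`. -/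
def IsGDivisible (G : Set (Ideal R)) : Prop :=
  ∀ a ∈ G, a • (⊤ : Submodule R M) = ⊤

/-- `M` is simple-`𝔊`-divisible. -/
def IsSimpleGDivisible (G : Set (Ideal R)) : Prop :=
  IsGDivisible R M G ∧ (∃ x : M, x ≠ 0) ∧
    ∀ V : Submodule R M, V ≠ ⊥ → V ≠ ⊤ → ¬ (∀ a ∈ G, a • V = V)

/-- `M` is a prime module. -/
def IsPrimeModule : Prop :=
  (∃ x : M, x ≠ 0) ∧ ∀ (r : R) (x : M), r • x = 0 → x = 0 ∨ ∀ y : M, r • y = 0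

/-- `M` is uniform: two nonzero submodules intersect nontrivially. -/
def IsUniformModule : Prop :=
  ∀ U V : Submodule R M, U ≠ ⊥ → V ≠ ⊥ → U ⊓ V ≠ ⊥

/-- `M` is supplemented. -/
def IsSupplementedModule : Prop :=
  ∀ U : Submodule R M, ∃ V : Submodule R M, U ⊔ V = ⊤ ∧
    ∀ W : Submodule R M, W ≤ V → U ⊔ W = ⊤ → W = V

/-- torsion-free (over a domain, element form). -/
def IsTorsionFreeMod : Prop :=
  ∀ d : R, d ≠ 0 → Function.Injective (fun x : M => d • x)

def IsSimpleTorsionFreeMod : Prop :=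
  IsTorsionFreeMod R M ∧ (∃ x : M, x ≠ 0) ∧
    ∀ U : Submodule R M, U ≠ ⊥ → U ≠ ⊤ → ¬ IsTorsionFreeMod R (M ⧸ U)

/-- divisible (over a domain, element form). -/
def IsDivisibleMod : Prop :=
  ∀ d : R, d ≠ 0 → Function.Surjective (fun x : M => d • x)

def IsSimpleDivisibleMod : Prop :=
  IsDivisibleMod R M ∧ (∃ x : M, x ≠ 0) ∧
    ∀ V : Submodule R M, V ≠ ⊥ → V ≠ ⊤ →
      ¬ (∀ d : R, d ≠ 0 → ∀ x ∈ V, ∃ y ∈ V, d • y = x)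

end Defs

/-- The residue field `κ(p) = R_p / p R_p`, as an `R`-module. -/
abbrev kappa (R : Type*) [CommRing R] (p : Ideal R) [p.IsPrime] : Type _ :=
  IsLocalRing.ResidueField (Localization.AtPrime p)


theorem IsGabrielTopology.inf_mem {R : Type*} [CommRing R] {G : Set (Ideal R)}
    (hG : IsGabrielTopology R G) {a b : Ideal R} (ha : a ∈ G) (hb : b ∈ G) : a ⊓ b ∈ G := by
  obtain ⟨-, hup, -, hgab⟩ := hG
  refine hgab _ ⟨a, ha, fun x hx => hup b _ hb fun r hr => ?_⟩
  rw [Submodule.mem_colon]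
  intro y hy
  obtain ⟨c, rfl⟩ := Ideal.mem_span_singleton'.mp hy
  exact ⟨a.mul_mem_left _ (a.mul_mem_left _ hx), b.mul_mem_right _ hr⟩

/-- The `G`-closure of a submodule `N`: the elements that some ideal of `G` multiplies into `N`. -/
def gabrielClosure {R : Type*} [CommRing R] {G : Set (Ideal R)} (hG : IsGabrielTopology R G)
    {M : Type*} [AddCommGroup M] [Module R M] (N : Submodule R M) : Submodule R M where
  carrier := {m | ∃ a ∈ G, ∀ r ∈ a, r • m ∈ N}
  zero_mem' := ⟨⊤, hG.1, fun r _ => by simp⟩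
  add_mem' := by
    rintro m n ⟨a, ha, hm⟩ ⟨b, hb, hn⟩
    refine ⟨a ⊓ b, hG.inf_mem ha hb, fun r hr => ?_⟩
    rw [smul_add]
    exact N.add_mem (hm r hr.1) (hn r hr.2)
  smul_mem' := by
    rintro c m ⟨a, ha, hm⟩
    refine ⟨a, ha, fun r hr => ?_⟩
    rw [smul_comm]
    exact N.smul_mem c (hm r hr)

section

variable {R : Type*} [CommRing R] {G : Set (Ideal R)} {M : Type*} [AddCommGroup M] [Module R M]

theorem mem_gabrielClosure (hG : IsGabrielTopology R G) {N : Submodule R M} {m : M} :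
    m ∈ gabrielClosure hG N ↔ ∃ a ∈ G, ∀ r ∈ a, r • m ∈ N :=
  Iff.rfl

theorem le_gabrielClosure (hG : IsGabrielTopology R G) (N : Submodule R M) :
    N ≤ gabrielClosure hG N :=
  fun _ hm => ⟨⊤, hG.1, fun r _ => N.smul_mem r hm⟩

theorem isGTorsionFree_quotient_iff (U : Submodule R M) :
    IsGTorsionFree R (M ⧸ U) G ↔ ∀ a ∈ G, ∀ m : M, (∀ r ∈ a, r • m ∈ U) → m ∈ U := by
  refine forall₂_congr fun a _ => U.mkQ_surjective.forall.trans (forall_congr' fun m => ?_)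
  simp only [Submodule.mkQ_apply, ← Submodule.Quotient.mk_smul, Submodule.Quotient.mk_eq_zero]

theorem isGTorsionFree_quotient_gabrielClosure (hG : IsGabrielTopology R G)
    (N : Submodule R M) : IsGTorsionFree R (M ⧸ gabrielClosure hG N) G := by
  rw [isGTorsionFree_quotient_iff]
  intro a ha m hm
  refine ⟨N.comap (LinearMap.toSpanSingleton R M m), ?_, fun r hr => by simpa using hr⟩
  refine hG.2.2.2 _ ⟨a, ha, fun x hx => ?_⟩
  obtain ⟨b, hb, hbx⟩ := hm x hx
  refine hG.2.1 b _ hb fun r hr => ?_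
  rw [Submodule.mem_colon]
  intro y hy
  obtain ⟨c, rfl⟩ := Ideal.mem_span_singleton'.mp hy
  have := N.smul_mem c (hbx r hr)
  simpa [smul_smul, mul_left_comm, mul_comm, mul_assoc] using this

theorem IsSimpleGTorsionFree.isPrimeModule (hM : IsSimpleGTorsionFree R M G) :
    IsPrimeModule R M := by
  obtain ⟨htf, hne, hsimple⟩ := hM
  refine ⟨hne, fun r x hrx => or_iff_not_imp_left.mpr fun hx y => ?_⟩
  let K := LinearMap.ker (LinearMap.lsmul R M r)
  have hK : K = ⊤ := by
    by_contra hK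
    refine hsimple K (fun h => hx ?_) hK ?_
    · have : x ∈ K := by simpa [K] using hrx
      simpa [h] using this
    · rw [isGTorsionFree_quotient_iff]
      intro a ha m hm
      have : r • m = 0 := htf a ha _ fun s hs => by
        have : r • s • m = 0 := hm s hs
        rwa [smul_comm]
      simpa [K] using this
  have : y ∈ K := hK ▸ Submodule.mem_top
  simpa [K] using this

theorem IsPrimeModule.mem_annihilator_iff (hM : IsPrimeModule R M) {x : M} (hx : x ≠ 0) {r : R} :
    r ∈ Module.annihilator R M ↔ r • x = 0 :=
  ⟨fun hr => Module.mem_annihilator.mp hr x, fun hr =>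
    Module.mem_annihilator.mpr ((hM.2 r x hr).resolve_left hx)⟩

theorem IsPrimeModule.annihilator_isPrime (hM : IsPrimeModule R M) :
    (Module.annihilator R M).IsPrime := by
  obtain ⟨x, hx⟩ := hM.1
  refine ⟨fun h => hx ?_, fun {r s} hrs => ?_⟩
  · have : (1 : R) ∈ Module.annihilator R M := h ▸ Submodule.mem_top
    simpa using (hM.mem_annihilator_iff hx).mp this
  · rw [hM.mem_annihilator_iff hx, mul_smul] at hrs
    exact (hM.2 r _ hrs).symm.imp Module.mem_annihilator.mpr (hM.mem_annihilator_iff hx).mpr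

end

theorem stmt2 (R : Type*) [CommRing R] [IsNoetherianRing R] [IsLocalRing R]
    (G : Set (Ideal R)) (hG : IsGabrielTopology R G)
    (M : Type*) [AddCommGroup M] [Module R M]
    (hM : IsSimpleGTorsionFree R M G) :
    Module.annihilator R M ∈ GStar R G := by
  have hprime := hM.isPrimeModule
  obtain ⟨htf, ⟨x, hx⟩, hsimple⟩ := hM
  refine ⟨hprime.annihilator_isPrime,
    fun h => hx (htf _ h x fun r hr => Module.mem_annihilator.mp hr x), fun q _ hpq => ?_⟩
  let N : Submodule R M := Submodule.map (LinearMap.toSpanSingleton R M x) q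
  have hbot : gabrielClosure hG N ≠ ⊥ := by
    obtain ⟨s, hsq, hsp⟩ := SetLike.exists_of_lt hpq
    intro h
    have : s • x ∈ gabrielClosure hG N := le_gabrielClosure hG N ⟨s, hsq, by simp⟩
    rw [h, Submodule.mem_bot] at this
    exact hsp ((hprime.mem_annihilator_iff hx).mpr this)
  have htop : gabrielClosure hG N = ⊤ := by
    by_contra h
    exact hsimple _ hbot h (isGTorsionFree_quotient_gabrielClosure hG N)
  have hxN : x ∈ gabrielClosure hG N := htop ▸ Submodule.mem_top
  obtain ⟨a, ha, hax⟩ := (mem_gabrielClosure hG).mp hxN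
  refine hG.2.1 a q ha fun r hr => ?_
  obtain ⟨t, htq, ht⟩ := hax r hr
  have hrt : r - t ∈ q := hpq.le <| (hprime.mem_annihilator_iff hx).mpr <| by
    rw [sub_smul, sub_eq_zero]
    simpa using ht.symm
  simpa using q.add_mem hrt htq
end

section
/- Let p ∈ 𝔊* and let N be an R-module with pN = 0. Then N is simple-𝔊-torsion-free if and only if N is simple-torsion-free as a module over the integral domain R/p. -/
/-- In a Noetherian ring, an ideal all of whose prime overideals lie in a Gabriel topology
lies in it. -/
lemma IsGabrielTopology.mem_of_forall_prime_mem {R : Type*} [CommRing R] [IsNoetherianRing R]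
    {G : Set (Ideal R)} (hG : IsGabrielTopology R G) (I : Ideal R)
    (hI : ∀ q : Ideal R, q.IsPrime → I ≤ q → q ∈ G) : I ∈ G := by
  obtain ⟨htop, hup, -, hext⟩ := hG
  by_contra hIG
  obtain ⟨J, ⟨hIJ, hJG⟩, hmax⟩ :=
    set_has_maximal_iff_noetherian.mpr (inferInstanceAs (IsNoetherian R R))
      {J : Ideal R | I ≤ J ∧ J ∉ G} ⟨I, le_rfl, hIG⟩
  have hmem : ∀ x ∉ J, J ⊔ Ideal.span {x} ∈ G := by
    intro x hx
    by_contra h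
    refine hmax _ ⟨hIJ.trans le_sup_left, h⟩ (lt_of_le_of_ne le_sup_left fun heq => hx ?_)
    rw [heq]
    exact Ideal.mem_sup_right (Ideal.mem_span_singleton_self x)
  refine hJG (hI J ⟨fun h => hJG (h ▸ htop), fun {a b} hab => ?_⟩ hIJ)
  by_contra! h
  refine hJG (hext J ⟨_, hmem a h.1, fun x hx => hup _ _ (hmem b h.2) ?_⟩)
  obtain ⟨j, hj, c, hc, rfl⟩ := Submodule.mem_sup.mp hx
  obtain ⟨e, rfl⟩ := Ideal.mem_span_singleton'.mp hc
  have key : ∀ r : R, r * (j + e * a) ∈ J →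
      r ∈ Submodule.colon J (Ideal.span {j + e * a} : Ideal R) := by
    intro r hr
    rw [Submodule.mem_colon]
    intro y hy
    obtain ⟨s, rfl⟩ := Ideal.mem_span_singleton'.mp hy
    rw [smul_eq_mul, mul_left_comm]
    exact Ideal.mul_mem_left J s hr
  refine sup_le (fun r hr => key r (Ideal.mul_mem_right _ J hr)) ?_
  rw [Ideal.span_singleton_le_iff_mem]
  refine key b ?_
  rw [show b * (j + e * a) = b * j + e * (a * b) by ring]
  exact J.add_mem (Ideal.mul_mem_left J _ hj) (Ideal.mul_mem_left J _ hab)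

/-- A module killed by `p ∈ 𝔊*` is `𝔊`-torsion-free if and only if the elements outside `p`
act injectively. -/
lemma isGTorsionFree_iff_of_mem_gStar {R : Type*} [CommRing R] [IsNoetherianRing R]
    {G : Set (Ideal R)} (hG : IsGabrielTopology R G) {p : Ideal R} (hp : p ∈ GStar R G)
    {M : Type*} [AddCommGroup M] [Module R M] (hM : ∀ r ∈ p, ∀ x : M, r • x = 0) :
    IsGTorsionFree R M G ↔ ∀ d ∉ p, ∀ x : M, d • x = 0 → x = 0 := by
  obtain ⟨-, hpG, hpmax⟩ := hp
  constructor
  · intro h d hd x hx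
    refine h (p ⊔ Ideal.span {d}) (hG.mem_of_forall_prime_mem _ fun q hq hle => ?_) x ?_
    · refine hpmax q hq (lt_of_le_of_ne (le_sup_left.trans hle) fun heq => hd ?_)
      rw [heq]
      exact hle (Ideal.mem_sup_right (Ideal.mem_span_singleton_self d))
    · intro r hr
      obtain ⟨s, hs, c, hc, rfl⟩ := Submodule.mem_sup.mp hr
      obtain ⟨e, rfl⟩ := Ideal.mem_span_singleton'.mp hc
      rw [add_smul, hM s hs, mul_smul, hx, smul_zero, add_zero]
  · intro h a ha x hx
    obtain ⟨r, hra, hrp⟩ := Set.not_subset.mp fun hle : a ≤ p => hpG (hG.2.1 a p ha hle)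
    exact h r hrp x (hx r hra)

lemma isTorsionFreeMod_quotient_iff {R : Type*} [CommRing R] {p : Ideal R}
    {M : Type*} [AddCommGroup M] [Module (R ⧸ p) M] :
    IsTorsionFreeMod (R ⧸ p) M ↔
      ∀ d ∉ p, ∀ x : M, Ideal.Quotient.mk p d • x = 0 → x = 0 := by
  constructor
  · intro h d hd x hx
    exact h _ (mt Ideal.Quotient.eq_zero_iff_mem.mp hd) (hx.trans (smul_zero _).symm)
  · intro h d hd x y hxy
    obtain ⟨d, rfl⟩ := Ideal.Quotient.mk_surjective d
    rw [← sub_eq_zero]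
    refine h d (mt Ideal.Quotient.eq_zero_iff_mem.mpr hd) _ ?_
    rw [smul_sub, sub_eq_zero]
    exact hxy

lemma forall_quotient_smul_eq_zero_iff {R M : Type*} [CommRing R] [AddCommGroup M] [Module R M]
    (U : Submodule R M) (d : R) :
    (∀ x : M ⧸ U, d • x = 0 → x = 0) ↔ ∀ x : M, d • x ∈ U → x ∈ U := by
  rw [U.mkQ_surjective.forall]
  simp only [Submodule.mkQ_apply, ← Submodule.Quotient.mk_smul, Submodule.Quotient.mk_eq_zero]

theorem stmt5 (R : Type*) [CommRing R] [IsNoetherianRing R] [IsLocalRing R]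
    (G : Set (Ideal R)) (hG : IsGabrielTopology R G)
    (p : Ideal R) (hp : p ∈ GStar R G)
    (N : Type*) [AddCommGroup N] [Module R N]
    (hpN : Module.IsTorsionBySet R N (p : Set R)) :
    IsSimpleGTorsionFree R N G ↔ @IsSimpleTorsionFreeMod (R ⧸ p) _ N _ hpN.module := by
  let _ := hpN.module
  have hN : ∀ r ∈ p, ∀ x : N, r • x = 0 := fun r hr x => hpN (x := x) (a := ⟨r, hr⟩)
  have hsmul : ∀ (d : R) (x : N), Ideal.Quotient.mk p d • x = d • x := fun _ _ => rfl
  have hquot : ∀ (U : Submodule R N) (V : Submodule (R ⧸ p) N), (∀ x, x ∈ U ↔ x ∈ V) →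
      (IsGTorsionFree R (N ⧸ U) G ↔ IsTorsionFreeMod (R ⧸ p) (N ⧸ V)) := by
    intro U V hUV
    rw [isGTorsionFree_iff_of_mem_gStar hG hp, isTorsionFreeMod_quotient_iff]
    · simp only [forall_quotient_smul_eq_zero_iff, hsmul, hUV]
    · intro r hr x
      obtain ⟨x, rfl⟩ := U.mkQ_surjective x
      rw [← map_smul, hN r hr, map_zero]
  refine and_congr ?_ (and_congr_right' ⟨fun h V hV hV' => ?_, fun h U hU hU' => ?_⟩)
  · rw [isGTorsionFree_iff_of_mem_gStar hG hp hN, isTorsionFreeMod_quotient_iff]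
    simp only [hsmul]
  · let U : Submodule R N :=
      { V.toAddSubmonoid with smul_mem' := fun r _ hx => V.smul_mem (Ideal.Quotient.mk p r) hx }
    have hUV : ∀ x, x ∈ U ↔ x ∈ V := fun _ => Iff.rfl
    rw [← hquot U V hUV]
    refine h U ?_ ?_
    · simpa [Submodule.eq_bot_iff, hUV] using hV
    · simpa [Submodule.eq_top_iff', hUV] using hV'
  · let V : Submodule (R ⧸ p) N :=
      { U.toAddSubmonoid with
        smul_mem' := fun r x hx => by
          obtain ⟨r, rfl⟩ := Ideal.Quotient.mk_surjective r
          exact U.smul_mem r hx }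
    have hUV : ∀ x, x ∈ U ↔ x ∈ V := fun _ => Iff.rfl
    rw [hquot U V hUV]
    refine h V ?_ ?_
    · simpa [Submodule.eq_bot_iff, hUV] using hU
    · simpa [Submodule.eq_top_iff', hUV] using hU'
end

section
/- Let p ∈ 𝔊* and let N be an R-module with pN = 0. Then N is simple-𝔊-divisible if and only if N is simple-divisible as a module over the integral domain R/p. -/
section GabrielTopology

variable {R : Type*} [CommRing R] {G : Set (Ideal R)}

theorem IsGabrielTopology.isOka (hG : IsGabrielTopology R G) : Ideal.IsOka (· ∈ G) := by
  obtain ⟨htop, hmono, -, hgab⟩ := hG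
  refine ⟨htop, fun {I a} hsup hcolon => hgab I ⟨_, hsup, fun x hx => hmono _ _ hcolon ?_⟩⟩
  obtain ⟨i, hi, z, hz, rfl⟩ := Submodule.mem_sup.1 hx
  obtain ⟨r, rfl⟩ := Ideal.mem_span_singleton'.1 hz
  intro y hy
  rw [Ideal.mem_colon_span_singleton] at hy ⊢
  rw [mul_add, mul_left_comm]
  exact I.add_mem (I.mul_mem_left y hi) (I.mul_mem_left r hy)

/-- Over a Noetherian ring, an ideal belongs to a Gabriel topology as soon as all the primes
containing it do. -/
theorem IsGabrielTopology.mem_of_forall_isPrime [IsNoetherianRing R]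
    (hG : IsGabrielTopology R G) {I : Ideal R} (h : ∀ q : Ideal R, q.IsPrime → I ≤ q → q ∈ G) :
    I ∈ G := by
  by_contra hI
  obtain ⟨q, hIq, hq⟩ := exists_maximal_ge_of_wellFoundedGT (fun J : Ideal R => J ∉ G) I hI
  exact hq.prop (h q (hG.isOka.isPrime_of_maximal_not hq) hIq)

theorem IsGabrielTopology.sup_span_singleton_mem [IsNoetherianRing R]
    (hG : IsGabrielTopology R G) {p : Ideal R} (hp : p ∈ GStar R G) {d : R} (hd : d ∉ p) :
    p ⊔ Ideal.span {d} ∈ G :=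
  hG.mem_of_forall_isPrime fun q hq hle =>
    hp.2.2 q hq ((Submodule.lt_sup_iff_notMem.2 hd).trans_le hle)

open scoped Pointwise in
/-- For a submodule killed by `p ∈ 𝔊*`, being `𝔊`-divisible amounts to being divisible by every
element outside `p`. -/
theorem IsGabrielTopology.forall_smul_eq_self_iff [IsNoetherianRing R]
    (hG : IsGabrielTopology R G) {p : Ideal R} (hp : p ∈ GStar R G)
    {N : Type*} [AddCommGroup N] [Module R N] (hpN : Module.IsTorsionBySet R N (p : Set R))
    (V : Submodule R N) :
    (∀ a ∈ G, a • V = V) ↔ ∀ d ∉ p, ∀ x ∈ V, ∃ y ∈ V, d • y = x := by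
  constructor
  · intro h d hd x hx
    have hpV : p • V = ⊥ := by
      rw [eq_bot_iff, Submodule.smul_le]
      exact fun r hr n _ => @hpN n ⟨r, hr⟩
    rw [← h _ (hG.sup_span_singleton_mem hp hd), Submodule.sup_smul, hpV, bot_sup_eq,
      Submodule.ideal_span_singleton_smul] at hx
    exact (Submodule.mem_smul_pointwise_iff_exists x d V).1 hx
  · intro h a ha
    refine le_antisymm Submodule.smul_le_right fun x hx => ?_
    obtain ⟨d, hda, hdp⟩ := SetLike.not_le_iff_exists.1 fun hle => hp.2.1 (hG.2.1 a p ha hle)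
    obtain ⟨y, hy, rfl⟩ := h d hdp x hx
    exact Submodule.smul_mem_smul hda hy

end GabrielTopology

theorem stmt6 (R : Type*) [CommRing R] [IsNoetherianRing R] [IsLocalRing R]
    (G : Set (Ideal R)) (hG : IsGabrielTopology R G)
    (p : Ideal R) (hp : p ∈ GStar R G)
    (N : Type*) [AddCommGroup N] [Module R N]
    (hpN : Module.IsTorsionBySet R N (p : Set R)) :
    IsSimpleGDivisible R N G ↔ @IsSimpleDivisibleMod (R ⧸ p) _ N _ hpN.module := by
  let := hpN.module
  have hmk (d : R) (x : N) : (Ideal.Quotient.mk p d) • x = d • x := rfl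
  have hdiv (V : Set N) : (∀ d : R ⧸ p, d ≠ 0 → ∀ x ∈ V, ∃ y ∈ V, d • y = x) ↔
      ∀ d ∉ p, ∀ x ∈ V, ∃ y ∈ V, d • y = x := by
    simp only [Ideal.Quotient.mk_surjective.forall, hmk, ne_eq, Ideal.Quotient.eq_zero_iff_mem]
  have hself := hG.forall_smul_eq_self_iff hp hpN
  refine and_congr ?_ (and_congr_right fun _ => ?_)
  · refine (hself ⊤).trans (((hdiv Set.univ).symm).trans ?_)
    simp [IsDivisibleMod, Function.Surjective]
  · constructor
    · intro h V hbot htop hV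
      let W : Submodule R N :=
        { V with smul_mem' := fun r _ hx => V.smul_mem (Ideal.Quotient.mk p r) hx }
      refine h W (fun hW => hbot ?_) (fun hW => htop ?_) ((hself W).2 ((hdiv V).1 hV))
      · exact SetLike.coe_injective (congrArg (fun U : Submodule R N => (U : Set N)) hW)
      · exact SetLike.coe_injective (congrArg (fun U : Submodule R N => (U : Set N)) hW)
    · intro h V hbot htop hV
      let W : Submodule (R ⧸ p) N :=
        { V with
          smul_mem' := fun r x hx => by
            obtain ⟨r, rfl⟩ := Ideal.Quotient.mk_surjective r
            exact V.smul_mem r hx }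
      refine h W (fun hW => hbot ?_) (fun hW => htop ?_) ((hdiv V).2 ((hself V).1 hV))
      · exact SetLike.coe_injective (congrArg (fun U : Submodule (R ⧸ p) N => (U : Set N)) hW)
      · exact SetLike.coe_injective (congrArg (fun U : Submodule (R ⧸ p) N => (U : Set N)) hW)
end

section
/- For an R-module M the following are equivalent: (i) M is simple-𝔊-torsion-free; (ii) M is prime, uniform, and Ann_R(M) ∈ 𝔊*; (iii) there exists p ∈ 𝔊* such that M ≠ 0 and there is an injective R-linear map M → κ(p). -/
namespace IsGabrielTopology

variable {R : Type*} [CommRing R] {G : Set (Ideal R)}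

theorem mem_of_forall_exists (hG : IsGabrielTopology R G) {a b : Ideal R} (ha : a ∈ G)
    (h : ∀ x ∈ a, ∃ c ∈ G, ∀ t ∈ c, t * x ∈ b) : b ∈ G := by
  refine hG.2.2.2 b ⟨a, ha, fun x hx => ?_⟩
  obtain ⟨c, hc, hcx⟩ := h x hx
  refine hG.2.1 c _ hc fun t ht => ?_
  rw [Ideal.mem_colon_span_singleton]
  exact hcx t ht

theorem inf_mem_s8 (hG : IsGabrielTopology R G) {a b : Ideal R} (ha : a ∈ G) (hb : b ∈ G) :
    a ⊓ b ∈ G :=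
  hG.mem_of_forall_exists ha fun x hx =>
    ⟨b, hb, fun t ht => ⟨a.mul_mem_left t hx, b.mul_mem_right x ht⟩⟩

theorem isPrime_of_maximal_notMem (hG : IsGabrielTopology R G) {p : Ideal R} (hp : p ∉ G)
    (hmax : ∀ q, p < q → q ∈ G) : p.IsPrime := by
  refine ⟨fun h => hp (h ▸ hG.1), fun {x y} hxy => ?_⟩
  by_contra! h
  have key : ∀ z ∉ p, p ⊔ Ideal.span {z} ∈ G := fun z hz =>
    hmax _ (lt_of_le_of_ne le_sup_left fun he => hz (by
      rw [he]; exact Ideal.mem_sup_right (Ideal.mem_span_singleton_self z)))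
  refine hp (hG.mem_of_forall_exists (key x h.1) fun z hz => ⟨_, key y h.2, fun t ht => ?_⟩)
  obtain ⟨u, hu, v, hv, rfl⟩ := Submodule.mem_sup.1 hz
  obtain ⟨u', hu', v', hv', rfl⟩ := Submodule.mem_sup.1 ht
  obtain ⟨c, rfl⟩ := Ideal.mem_span_singleton'.1 hv
  obtain ⟨d, rfl⟩ := Ideal.mem_span_singleton'.1 hv'
  have : (u' + d * y) * (u + c * x) = (u' + d * y) * u + (c * x) * u' + (d * c) * (x * y) := by
    ring
  rw [this]
  exact p.add_mem (p.add_mem (p.mul_mem_left _ hu) (p.mul_mem_left _ hu')) (p.mul_mem_left _ hxy)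

theorem exists_le_isPrime_notMem [IsNoetherianRing R] (hG : IsGabrielTopology R G) {a : Ideal R}
    (ha : a ∉ G) : ∃ q : Ideal R, q.IsPrime ∧ a ≤ q ∧ q ∉ G := by
  obtain ⟨q, ⟨haq, hq⟩, hmax⟩ := set_has_maximal_iff_noetherian.2 ‹IsNoetherianRing R›
    {b : Ideal R | a ≤ b ∧ b ∉ G} ⟨a, le_rfl, ha⟩
  refine ⟨q, hG.isPrime_of_maximal_notMem hq fun b hb => ?_, haq, hq⟩
  by_contra hbG
  exact hmax b ⟨haq.trans hb.le, hbG⟩ hb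

theorem mem_of_mem_gStar_of_lt [IsNoetherianRing R] (hG : IsGabrielTopology R G) {p a : Ideal R}
    (hp : p ∈ GStar R G) (hpa : p < a) : a ∈ G := by
  by_contra ha
  obtain ⟨q, hq, haq, hqG⟩ := hG.exists_le_isPrime_notMem ha
  exact hqG (hp.2.2 q hq (hpa.trans_le haq))

variable {M : Type*} [AddCommGroup M] [Module R M]

/-- The `G`-closure of `U`: the preimage in `M` of the `G`-torsion submodule of `M ⧸ U`. -/
def closure (hG : IsGabrielTopology R G) (U : Submodule R M) : Submodule R M where
  carrier := {x | ∃ a ∈ G, ∀ r ∈ a, r • x ∈ U}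
  zero_mem' := ⟨⊤, hG.1, fun r _ => by simp⟩
  add_mem' := by
    rintro x y ⟨a, ha, hx⟩ ⟨b, hb, hy⟩
    refine ⟨a ⊓ b, hG.inf_mem_s8 ha hb, fun r hr => ?_⟩
    rw [smul_add]
    exact U.add_mem (hx r hr.1) (hy r hr.2)
  smul_mem' := by
    rintro c x ⟨a, ha, hx⟩
    refine ⟨a, ha, fun r hr => ?_⟩
    rw [smul_comm]
    exact U.smul_mem c (hx r hr)

theorem mem_closure (hG : IsGabrielTopology R G) {U : Submodule R M} {x : M} :
    x ∈ hG.closure U ↔ ∃ a ∈ G, ∀ r ∈ a, r • x ∈ U :=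
  Iff.rfl

theorem le_closure (hG : IsGabrielTopology R G) (U : Submodule R M) : U ≤ hG.closure U :=
  fun _ hx => ⟨⊤, hG.1, fun r _ => U.smul_mem r hx⟩

theorem isGTorsionFree_quotient_closure (hG : IsGabrielTopology R G) (U : Submodule R M) :
    IsGTorsionFree R (M ⧸ hG.closure U) G := by
  intro a ha x hx
  induction x using Submodule.Quotient.induction_on with | H m => ?_
  simp only [← Submodule.Quotient.mk_smul, Submodule.Quotient.mk_eq_zero] at hx ⊢
  refine ⟨U.comap (LinearMap.toSpanSingleton R M m), hG.mem_of_forall_exists ha fun r hr => ?_,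
    fun r hr => by simpa using hr⟩
  obtain ⟨c, hc, hcr⟩ := hx r hr
  exact ⟨c, hc, fun t ht => by simpa [mul_smul] using hcr t ht⟩

theorem closure_eq_top_of_isSimple (hG : IsGabrielTopology R G)
    (hM : IsSimpleGTorsionFree R M G) {U : Submodule R M} (hU : U ≠ ⊥) : hG.closure U = ⊤ := by
  by_contra h
  exact hM.2.2 _ (fun h0 => hU (le_bot_iff.1 (h0 ▸ hG.le_closure U))) h
    (hG.isGTorsionFree_quotient_closure U)

theorem exists_smul_mem_of_isSimple (hG : IsGabrielTopology R G)
    (hM : IsSimpleGTorsionFree R M G) {U : Submodule R M} (hU : U ≠ ⊥) (x : M) :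
    ∃ a ∈ G, ∀ r ∈ a, r • x ∈ U :=
  hG.mem_closure.1 (hG.closure_eq_top_of_isSimple hM hU ▸ Submodule.mem_top)

end IsGabrielTopology

namespace IsPrimeModule

variable {R : Type*} [CommRing R] {M : Type*} [AddCommGroup M] [Module R M]

theorem mem_annihilator_of_smul_eq_zero (hM : IsPrimeModule R M) {r : R} {x : M} (hx : x ≠ 0)
    (h : r • x = 0) : r ∈ Module.annihilator R M :=
  Module.mem_annihilator.2 ((hM.2 r x h).resolve_left hx)

theorem annihilator_isPrime_s8 (hM : IsPrimeModule R M) : (Module.annihilator R M).IsPrime := by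
  obtain ⟨x, hx⟩ := hM.1
  refine ⟨fun h => hx ?_, fun {a b} hab => ?_⟩
  · simpa using Module.mem_annihilator.1 ((Ideal.eq_top_iff_one _).1 h) x
  · by_cases hb : b • x = 0
    · exact Or.inr (hM.mem_annihilator_of_smul_eq_zero hx hb)
    · refine Or.inl (hM.mem_annihilator_of_smul_eq_zero hb ?_)
      rw [← mul_smul]
      exact Module.mem_annihilator.1 hab x

theorem exists_smul_eq_smul (hM : IsPrimeModule R M) (hU : IsUniformModule R M) {x : M}
    (hx : x ≠ 0) (y : M) : ∃ s ∉ Module.annihilator R M, ∃ r : R, s • y = r • x := by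
  by_cases hy : y = 0
  · exact ⟨1, fun h => hM.annihilator_isPrime_s8.ne_top ((Ideal.eq_top_iff_one _).2 h), 0, by simp [hy]⟩
  · obtain ⟨z, ⟨hzx, hzy⟩, hz⟩ := (Submodule.ne_bot_iff _).1
      (hU (Submodule.span R {x}) (Submodule.span R {y}) (by simpa using hx) (by simpa using hy))
    obtain ⟨r, hr⟩ := Submodule.mem_span_singleton.1 hzx
    obtain ⟨s, hs⟩ := Submodule.mem_span_singleton.1 hzy
    exact ⟨s, fun h => hz (hs ▸ Module.mem_annihilator.1 h y), r, hs.trans hr.symm⟩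

/-- A prime uniform module embeds into any field `K` in which its annihilator is the kernel of
the structure map. -/
theorem exists_injective_linearMap (hM : IsPrimeModule R M) (hU : IsUniformModule R M)
    (K : Type*) [Field K] [Algebra R K]
    (hK : ∀ r, algebraMap R K r = 0 ↔ r ∈ Module.annihilator R M) :
    ∃ f : M →ₗ[R] K, Function.Injective f := by
  obtain ⟨x, hx⟩ := hM.1
  have hprime := hM.annihilator_isPrime_s8
  choose s hs r hsr using hM.exists_smul_eq_smul hU hx
  have hne : ∀ t ∉ Module.annihilator R M, algebraMap R K t ≠ 0 := fun t ht h => ht ((hK t).1 h)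
  have key : ∀ y, ∀ t ∉ Module.annihilator R M, ∀ u : R, t • y = u • x →
      algebraMap R K (r y) / algebraMap R K (s y) = algebraMap R K u / algebraMap R K t := by
    intro y t ht u h
    rw [div_eq_div_iff (hne _ (hs y)) (hne t ht), ← map_mul, ← map_mul, ← sub_eq_zero, ← map_sub,
      hK]
    refine hM.mem_annihilator_of_smul_eq_zero hx ?_
    rw [sub_smul, mul_comm, mul_smul, ← hsr, mul_comm, mul_smul, ← h, smul_comm, sub_self]
  refine ⟨{ toFun := fun y => algebraMap R K (r y) / algebraMap R K (s y)
            map_add' := fun y z => ?_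
            map_smul' := fun c y => ?_ }, ?_⟩
  · rw [key (y + z) (s y * s z) (hprime.mul_notMem (hs y) (hs z)) (s z * r y + s y * r z)]
    · have := hne _ (hs y)
      have := hne _ (hs z)
      simp only [map_mul, map_add]
      field_simp
    · rw [smul_add, add_smul, mul_smul (s z), ← hsr y, mul_smul (s y) (r z), ← hsr z, mul_smul,
        mul_smul, smul_comm (s y) (s z) y]
  · rw [key (c • y) (s y) (hs y) (c * r y), RingHom.id_apply, Algebra.smul_def, map_mul,
      mul_div_assoc]
    rw [mul_smul, ← hsr, smul_comm]
  · rw [injective_iff_map_eq_zero]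
    intro y hy
    have hr : algebraMap R K (r y) = 0 :=
      (div_eq_zero_iff.1 hy).resolve_right (hne _ (hs y))
    have : s y • y = 0 := by rw [hsr, Module.mem_annihilator.1 ((hK _).1 hr)]
    by_contra hy0
    exact hs y (hM.mem_annihilator_of_smul_eq_zero hy0 this)

end IsPrimeModule

namespace IsSimpleGTorsionFree

variable {R : Type*} [CommRing R] {G : Set (Ideal R)} {M : Type*} [AddCommGroup M] [Module R M]

theorem isUniformModule (hM : IsSimpleGTorsionFree R M G) (hG : IsGabrielTopology R G) :
    IsUniformModule R M := by
  intro U V hU hV h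
  refine hV ((Submodule.eq_bot_iff _).2 fun v hv => ?_)
  obtain ⟨a, ha, hav⟩ := hG.exists_smul_mem_of_isSimple hM hU v
  exact hM.1 a ha v fun r hr =>
    (Submodule.mem_bot R).1 (h ▸ ⟨hav r hr, V.smul_mem r hv⟩)

theorem isPrimeModule_s8 (hM : IsSimpleGTorsionFree R M G) (hG : IsGabrielTopology R G) :
    IsPrimeModule R M := by
  refine ⟨hM.2.1, fun r x hrx => or_iff_not_imp_left.2 fun hx y => ?_⟩
  have hU : LinearMap.ker (LinearMap.lsmul R M r) ≠ ⊥ :=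
    (Submodule.ne_bot_iff _).2 ⟨x, by simpa using hrx, hx⟩
  obtain ⟨a, ha, hay⟩ := hG.exists_smul_mem_of_isSimple hM hU y
  refine hM.1 a ha _ fun t ht => ?_
  simpa [smul_comm t r y] using hay t ht

theorem annihilator_mem_gStar (hM : IsSimpleGTorsionFree R M G) (hG : IsGabrielTopology R G) :
    Module.annihilator R M ∈ GStar R G := by
  have hP := hM.isPrimeModule_s8 hG
  obtain ⟨x, hx⟩ := hP.1
  refine ⟨hP.annihilator_isPrime_s8, fun h => hx (hM.1 _ h x fun r hr =>
    Module.mem_annihilator.1 hr x), fun q _ hq => ?_⟩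
  obtain ⟨hle, s, hsq, hs⟩ := SetLike.lt_iff_le_and_exists.1 hq
  have hsx : Submodule.span R {s • x} ≠ ⊥ := by
    simpa using fun h => hs (hP.mem_annihilator_of_smul_eq_zero hx h)
  obtain ⟨a, ha, hax⟩ := hG.exists_smul_mem_of_isSimple hM hsx x
  refine hG.2.1 a q ha fun r hr => ?_
  obtain ⟨t, ht⟩ := Submodule.mem_span_singleton.1 (hax r hr)
  have : r - t * s ∈ q := hle (hP.mem_annihilator_of_smul_eq_zero hx (by
    rw [sub_smul, mul_smul, ht, sub_self]))
  simpa using q.add_mem this (q.mul_mem_left t hsq)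

end IsSimpleGTorsionFree

theorem isSimpleGTorsionFree_of_injective {R : Type*} [CommRing R] [IsNoetherianRing R]
    {G : Set (Ideal R)} (hG : IsGabrielTopology R G) {M : Type*} [AddCommGroup M] [Module R M]
    {p : Ideal R} [p.IsPrime] (hp : p ∈ GStar R G) (hM : ∃ x : M, x ≠ 0)
    {f : M →ₗ[R] kappa R p} (hf : Function.Injective f) : IsSimpleGTorsionFree R M G := by
  have hK : ∀ r, algebraMap R (kappa R p) r = 0 ↔ r ∈ p := fun r =>
    Ideal.algebraMap_residueField_eq_zero
  refine ⟨fun a ha x hax => ?_, hM, fun U hU hU' hT => hU' ?_⟩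
  · by_contra hx
    refine hp.2.1 (hG.2.1 a p ha fun r hr => (hK r).1 ?_)
    have h : r • f x = 0 := by rw [← map_smul, hax r hr, map_zero]
    rw [Algebra.smul_def] at h
    exact (mul_eq_zero.1 h).resolve_right ((map_ne_zero_iff f hf).2 hx)
  · refine (Submodule.eq_top_iff').2 fun m => ?_
    obtain ⟨u, huU, hu⟩ := (Submodule.ne_bot_iff _).1 hU
    have hfu : f u ≠ 0 := (map_ne_zero_iff f hf).2 hu
    obtain ⟨r', s', hs', hrs⟩ := IsFractionRing.div_surjective (A := R ⧸ p) (f m / f u)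
    obtain ⟨r, rfl⟩ := Ideal.Quotient.mk_surjective r'
    obtain ⟨s, rfl⟩ := Ideal.Quotient.mk_surjective s'
    have hs : s ∉ p := fun h => nonZeroDivisors.ne_zero hs' (Ideal.Quotient.eq_zero_iff_mem.2 h)
    have hrs : algebraMap R (kappa R p) r / algebraMap R (kappa R p) s = f m / f u := hrs
    have hsm : s • m = r • u := hf (by
      rw [div_eq_div_iff (mt (hK s).1 hs) hfu] at hrs
      rw [map_smul, map_smul, Algebra.smul_def, Algebra.smul_def, hrs, mul_comm])
    have ha : p ⊔ Ideal.span {s} ∈ G := hG.mem_of_mem_gStar_of_lt hp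
      (lt_of_le_of_ne le_sup_left fun he => hs (by
        rw [he]; exact Ideal.mem_sup_right (Ideal.mem_span_singleton_self s)))
    rw [← Submodule.Quotient.mk_eq_zero]
    refine hT _ ha _ fun t ht => ?_
    rw [← Submodule.Quotient.mk_smul, Submodule.Quotient.mk_eq_zero]
    obtain ⟨b, hb, v, hv, rfl⟩ := Submodule.mem_sup.1 ht
    obtain ⟨c, rfl⟩ := Ideal.mem_span_singleton'.1 hv
    have hbm : b • m = 0 := hf (by
      rw [map_smul, Algebra.smul_def, (hK b).2 hb, zero_mul, map_zero])
    rw [add_smul, hbm, zero_add, mul_smul, hsm]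
    exact U.smul_mem c (U.smul_mem r huU)

theorem stmt8 (R : Type*) [CommRing R] [IsNoetherianRing R] [IsLocalRing R]
    (G : Set (Ideal R)) (hG : IsGabrielTopology R G)
    (M : Type*) [AddCommGroup M] [Module R M] :
    List.TFAE
      [ IsSimpleGTorsionFree R M G,
        IsPrimeModule R M ∧ IsUniformModule R M ∧ Module.annihilator R M ∈ GStar R G,
        ∃ (p : Ideal R) (hp : p.IsPrime), p ∈ GStar R G ∧ (∃ x : M, x ≠ 0) ∧
          ∃ f : M →ₗ[R] kappa R p, Function.Injective f ] := by
  tfae_have 1 → 2 := fun h =>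
    ⟨h.isPrimeModule_s8 hG, h.isUniformModule hG, h.annihilator_mem_gStar hG⟩
  tfae_have 2 → 3 := fun ⟨hP, hU, hA⟩ =>
    have := hA.1
    ⟨_, hA.1, hA, hP.1, hP.exists_injective_linearMap hU _ fun _ =>
      Ideal.algebraMap_residueField_eq_zero⟩
  tfae_have 3 → 1 := fun ⟨_, _, hp, hM, _, hf⟩ => isSimpleGTorsionFree_of_injective hG hp hM hf
  tfae_finish
end

section
/- Let S be a multiplicative subset of R and let M = R_S (the localization of R at S) be regarded as an R-module. The following are equivalent: (i) M is a prime R-module; (ii) Ann_R(M) is a prime ideal of R; (iii) the ring R_S is an integral domain; (iv) there exists a prime ideal p of R such that M ≠ 0 and there is an injective R-linear map M → κ(p). -/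
theorem mem_annihilator_iff_algebraMap_eq_zero {R A : Type*} [CommRing R] [CommRing A]
    [Algebra R A] (r : R) : r ∈ Module.annihilator R A ↔ algebraMap R A r = 0 := by
  rw [Module.mem_annihilator]
  constructor
  · intro h
    simpa [Algebra.smul_def] using h 1
  · intro h y
    rw [Algebra.smul_def, h, zero_mul]

theorem IsPrimeModule.annihilator_isPrime_s10 {R M : Type*} [CommRing R] [AddCommGroup M]
    [Module R M] (h : IsPrimeModule R M) : (Module.annihilator R M).IsPrime := by
  obtain ⟨⟨x, hx⟩, h⟩ := h
  refine ⟨fun htop => hx ?_, fun {a b} hab => ?_⟩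
  · have h1 : (1 : R) ∈ Module.annihilator R M := htop ▸ Submodule.mem_top
    simpa using Module.mem_annihilator.1 h1 x
  · by_contra! hc
    obtain ⟨ha, hb⟩ := hc
    have habx : a • b • x = 0 := by
      rw [← mul_smul]
      exact Module.mem_annihilator.1 hab x
    rcases h a _ habx with hbx | hay
    · rcases h b x hbx with hx0 | hby
      · exact hx hx0
      · exact hb (Module.mem_annihilator.2 hby)
    · exact ha (Module.mem_annihilator.2 hay)

theorem IsLocalization.isDomain_of_annihilator_isPrime {R : Type*} [CommRing R] (S : Submonoid R)
    (A : Type*) [CommRing A] [Algebra R A] [IsLocalization S A]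
    (h : (Module.annihilator R A).IsPrime) : IsDomain A := by
  have hnt : Nontrivial A := by
    by_contra hn
    rw [not_nontrivial_iff_subsingleton] at hn
    exact h.ne_top (Module.annihilator_eq_top_iff.2 hn)
  have hnzd : NoZeroDivisors A := by
    refine ⟨fun {x y} hxy => ?_⟩
    obtain ⟨a, s, rfl⟩ := IsLocalization.exists_mk'_eq S x
    obtain ⟨b, t, rfl⟩ := IsLocalization.exists_mk'_eq S y
    have key : ∀ (c : R) (u : S), IsLocalization.mk' A c u = 0 ↔
        c ∈ Module.annihilator R A := fun c u => by
      rw [mem_annihilator_iff_algebraMap_eq_zero, IsLocalization.mk'_eq_zero_iff,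
        IsLocalization.map_eq_zero_iff S]
    rw [← IsLocalization.mk'_mul, key] at hxy
    rw [key, key]
    exact h.mem_or_mem hxy
  exact NoZeroDivisors.to_isDomain A

theorem IsLocalization.exists_injective_to_residueField {R : Type*} [CommRing R]
    (S : Submonoid R) (A : Type*) [CommRing A] [IsDomain A] [Algebra R A] [IsLocalization S A] :
    ∃ (p : Ideal R) (_ : p.IsPrime), ∃ f : A →ₗ[R] kappa R p, Function.Injective f := by
  have hp : (RingHom.ker (algebraMap R A)).IsPrime := RingHom.ker_isPrime _
  refine ⟨RingHom.ker (algebraMap R A), hp, ?_⟩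
  set p := RingHom.ker (algebraMap R A) with hpdef
  have hzero : ∀ r : R, algebraMap R (kappa R p) r = 0 ↔ r ∈ p := fun r =>
    Ideal.algebraMap_residueField_eq_zero
  have hunit : ∀ s : S, IsUnit (algebraMap R (kappa R p) s) := fun s => by
    rw [isUnit_iff_ne_zero, Ne, hzero]
    exact (IsLocalization.map_units A s).ne_zero
  let g : A →ₐ[R] kappa R p :=
    { IsLocalization.lift hunit with
      commutes' := fun r => IsLocalization.lift_eq hunit r }
  refine ⟨g.toLinearMap, (injective_iff_map_eq_zero g).2 fun x hx => ?_⟩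
  obtain ⟨a, s, rfl⟩ := IsLocalization.exists_mk'_eq S x
  have ha : algebraMap R (kappa R p) a = 0 := by
    rw [← g.commutes a, ← IsLocalization.mk'_spec A a s, map_mul, hx, zero_mul]
  have ha' : algebraMap R A a = 0 := (hzero a).1 ha
  rwa [IsLocalization.mk'_eq_zero_iff, ← IsLocalization.map_eq_zero_iff S A]

theorem IsPrimeModule.of_injective_to_field {R M K : Type*} [CommRing R] [AddCommGroup M]
    [Module R M] [Field K] [Algebra R K] (hM : ∃ x : M, x ≠ 0) (f : M →ₗ[R] K)
    (hf : Function.Injective f) : IsPrimeModule R M := by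
  refine ⟨hM, fun r x hrx => ?_⟩
  have h : algebraMap R K r * f x = 0 := by
    rw [← Algebra.smul_def, ← map_smul, hrx, map_zero]
  rcases mul_eq_zero.1 h with hr | hx
  · refine Or.inr fun y => hf ?_
    rw [map_smul, map_zero, Algebra.smul_def, hr, zero_mul]
  · exact Or.inl (hf (by rw [hx, map_zero]))

theorem stmt10 (R : Type*) [CommRing R] [IsNoetherianRing R] [IsLocalRing R]
    (S : Submonoid R) :
    List.TFAE
      [ IsPrimeModule R (Localization S),
        (Module.annihilator R (Localization S)).IsPrime,
        IsDomain (Localization S),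
        ∃ (p : Ideal R) (hp : p.IsPrime), (∃ x : Localization S, x ≠ 0) ∧
          ∃ f : Localization S →ₗ[R] kappa R p, Function.Injective f ] := by
  tfae_have 1 → 2 := IsPrimeModule.annihilator_isPrime_s10
  tfae_have 2 → 3 := IsLocalization.isDomain_of_annihilator_isPrime S _
  tfae_have 3 → 4 := by
    intro _
    obtain ⟨p, hp, f, hf⟩ := IsLocalization.exists_injective_to_residueField S (Localization S)
    exact ⟨p, hp, exists_ne 0, f, hf⟩
  tfae_have 4 → 1 := by
    rintro ⟨p, _, hM, f, hf⟩
    exact IsPrimeModule.of_injective_to_field hM f hf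
  tfae_finish
end

section
/- Let N be a simple-𝔊-divisible R-module that is supplemented. Then for every Artinian submodule V ⊊ N there exists 𝔞₀ ∈ 𝔊 with 𝔞₀V = 0, and there exists a surjective R-linear map N/V → N. -/
theorem IsGabrielTopology.mul_mem {R : Type*} [CommRing R] {G : Set (Ideal R)}
    (hG : IsGabrielTopology R G) {a b : Ideal R} (ha : a ∈ G) (hb : b ∈ G) : b * a ∈ G := by
  refine hG.2.2.2 _ ⟨a, ha, fun x hx => hG.2.1 b _ hb fun r hr => ?_⟩
  rw [Submodule.mem_colon]
  intro y hy
  obtain ⟨c, rfl⟩ := Ideal.mem_span_singleton'.1 hy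
  exact Ideal.mul_mem_mul hr (a.mul_mem_left c hx)

/-- An Artinian submodule `V` has a least multiple `a • V` with `a ∈ G`, which is `G`-divisible. -/
theorem IsGabrielTopology.exists_smul_isDivisible {R : Type*} [CommRing R] {G : Set (Ideal R)}
    (hG : IsGabrielTopology R G) {N : Type*} [AddCommGroup N] [Module R N]
    (V : Submodule R N) [IsArtinian R V] : ∃ a ∈ G, ∀ b ∈ G, b • a • V = a • V := by
  obtain ⟨_, ⟨a, ha, rfl⟩, hmin⟩ := IsArtinian.set_has_minimal
    ((fun a : Ideal R => a • (⊤ : Submodule R V)) '' G) ⟨_, ⊤, hG.1, rfl⟩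
  have key (c : Ideal R) : (c • (⊤ : Submodule R V)).map V.subtype = c • V := by
    rw [Submodule.map_smul'', Submodule.map_subtype_top]
  refine ⟨a, ha, fun b hb => ?_⟩
  have hle : (b * a) • (⊤ : Submodule R V) ≤ a • ⊤ := 
    Submodule.smul_mono_left Ideal.mul_le_right
  have heq := eq_of_le_of_not_lt hle (hmin _ ⟨b * a, hG.mul_mem ha hb, rfl⟩)
  rw [← mul_smul, ← key, ← key, heq]

/-- Nonzero endomorphisms of a simple-`G`-divisible module are surjective. -/
theorem IsSimpleGDivisible.surjective_of_ne_zero {R : Type*} [CommRing R] {G : Set (Ideal R)}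
    {N : Type*} [AddCommGroup N] [Module R N] (hN : IsSimpleGDivisible R N G)
    {f : N →ₗ[R] N} (hf : f ≠ 0) : Function.Surjective f := by
  rw [← LinearMap.range_eq_top]
  by_contra h
  refine hN.2.2 _ (mt LinearMap.range_eq_bot.1 hf) h fun a ha => ?_
  rw [← Submodule.map_top, ← Submodule.map_smul'', hN.1 a ha]

theorem stmt16 (R : Type*) [CommRing R] [IsNoetherianRing R] [IsLocalRing R]
    (G : Set (Ideal R)) (hG : IsGabrielTopology R G)
    (N : Type*) [AddCommGroup N] [Module R N]
    (hN : IsSimpleGDivisible R N G) (hsupp : IsSupplementedModule R N)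
    (V : Submodule R N) (hV : V ≠ ⊤) (hart : IsArtinian R V) :
    (∃ a ∈ G, ∀ r ∈ a, ∀ x ∈ V, r • x = 0) ∧
    ∃ f : (N ⧸ V) →ₗ[R] N, Function.Surjective f := by
  obtain ⟨a, ha, hdiv⟩ := hG.exists_smul_isDivisible V
  have hbot : a • V = ⊥ := by
    by_contra h
    exact hN.2.2 _ h (fun ht => hV (top_le_iff.1 (ht ▸ Submodule.smul_le_right))) hdiv
  have hkill : ∀ r ∈ a, ∀ x ∈ V, r • x = 0 := fun r hr x hx =>
    (Submodule.mem_bot R).1 (hbot ▸ Submodule.smul_mem_smul hr hx)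
  refine ⟨⟨a, ha, hkill⟩, ?_⟩
  obtain ⟨r, hr, hne⟩ : ∃ r ∈ a, LinearMap.lsmul R N r ≠ 0 := by
    by_contra! h
    obtain ⟨x, hx⟩ := hN.2.1
    have htop : (⊤ : Submodule R N) ≤ ⊥ := by
      rw [← hN.1 a ha, Submodule.smul_le]
      exact fun r hr n _ => (Submodule.mem_bot R).2 (LinearMap.congr_fun (h r hr) n)
    exact hx ((Submodule.mem_bot R).1 (htop Submodule.mem_top))
  refine ⟨V.liftQ (LinearMap.lsmul R N r) fun x hx => hkill r hr x hx, fun y => ?_⟩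
  obtain ⟨x, rfl⟩ := hN.surjective_of_ne_zero hne y
  exact ⟨V.mkQ x, V.liftQ_apply _ x⟩
end
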